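/- Let a(𝐳), b(𝐳) be local homogeneous End(E)-valued distributions. Then they satisfy skew-symmetry for (∂_z, ∂_z̄): for every 𝐧=(n,n̄)∈𝕂̄, (−1)^{|a||b|}·b(𝐳)_(𝐧)a(𝐳) = Σ_{𝐢=(i,ī)∈ℕ²} (−1)^{(n+i)−(n̄+ī)} ∂_z^{(i)}∂_z̄^{(ī)}(a(𝐳)_{(𝐧+𝐢)}b(𝐳)), where only finitely many terms of the sum are nonzero. -/

import Mathlib

open scoped BigOperators Classical

noncomputable section

namespace OPEA

variable (K : Type*) [Field K] [CharZero K]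

/-- index pairs 𝐧 = (n, n̄) ∈ K² -/
abbrev Idx := K × K

def IsInt (x : K) : Prop := ∃ k : ℤ, (k : K) = x

def IsNegInt (x : K) : Prop := ∃ k : ℤ, k < 0 ∧ (k : K) = x

/-- 𝕂̄ = {𝐧 ∈ K² | n − n̄ ∈ ℤ} -/
def Kbar (n : Idx K) : Prop := IsInt K (n.1 - n.2)

def IsIntPair (n : Idx K) : Prop := IsInt K n.1 ∧ IsInt K n.2

/-- generalized binomial coefficient C(x,k) -/
def gchoose (x : K) (k : ℕ) : K :=
  (∏ i ∈ Finset.range k, (x - (i : K))) / (k.factorial : K)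

/-- (−1)^x for x an integer image in K (and 1 otherwise) -/
def negOnePow (x : K) : K :=
  if h : ∃ k : ℤ, (k : K) = x then (-1 : K) ^ h.choose else 1

variable (M : Type*) [AddCommGroup M] [Module K M]

/-- M-valued distribution in one variable pair -/
abbrev Dist1 := Idx K → M

/-- M-valued distribution in two variable pairs -/
abbrev Dist2 := Idx K → Idx K → M

/-- M-valued distribution in r variable pairs -/
abbrev DistN (r : ℕ) := (Fin r → Idx K) → M

/-- membership in M[[𝐳]] -/
def IsPow1 (a : Dist1 K M) : Prop := ∀ n, a n ≠ 0 → IsNegInt K n.1 ∧ IsNegInt K n.2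

/-- membership in M⌊𝐳⌋ -/
def InLat1 (a : Dist1 K M) : Prop :=
  ∃ S : Finset (Idx K), ∀ n, a n ≠ 0 →
    ∃ m ∈ S, IsNegInt K (n.1 - m.1) ∧ IsNegInt K (n.2 - m.2)

/-- membership in M[[𝐳,𝐰]] -/
def IsPow2 (a : Dist2 K M) : Prop :=
  ∀ n k, a n k ≠ 0 →
    (IsNegInt K n.1 ∧ IsNegInt K n.2) ∧ (IsNegInt K k.1 ∧ IsNegInt K k.2)

/-- membership in M⌊𝐳,𝐰⌋ -/
def InLat2 (a : Dist2 K M) : Prop :=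
  ∃ S : Finset (Idx K × Idx K), ∀ n k, a n k ≠ 0 →
    ∃ m ∈ S, (IsNegInt K (n.1 - m.1.1) ∧ IsNegInt K (n.2 - m.1.2)) ∧
      (IsNegInt K (k.1 - m.2.1) ∧ IsNegInt K (k.2 - m.2.2))

/-- membership in M[[𝐳₁,…,𝐳ᵣ]] -/
def IsPowN {r : ℕ} (a : DistN K M r) : Prop :=
  ∀ n, a n ≠ 0 → ∀ i, IsNegInt K (n i).1 ∧ IsNegInt K (n i).2

/-- membership in M⌊𝐳₁,…,𝐳ᵣ⌋ -/
def InLatN {r : ℕ} (a : DistN K M r) : Prop :=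
  ∃ S : Finset (Fin r → Idx K), ∀ n, a n ≠ 0 →
    ∃ m ∈ S, ∀ i, IsNegInt K ((n i).1 - (m i).1) ∧ IsNegInt K ((n i).2 - (m i).2)

/-- ∂_z -/
def dz (a : Dist1 K M) : Dist1 K M := fun n => (-n.1) • a (n.1 - 1, n.2)

/-- ∂_z̄ -/
def dzb (a : Dist1 K M) : Dist1 K M := fun n => (-n.2) • a (n.1, n.2 - 1)

/-- ∂ in the first variable pair of a two-variable distribution (z-component) -/
def d1z (c : Dist2 K M) : Dist2 K M := fun n k => (-n.1) • c (n.1 - 1, n.2) k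

/-- ∂ in the first variable pair of a two-variable distribution (z̄-component) -/
def d1zb (c : Dist2 K M) : Dist2 K M := fun n k => (-n.2) • c (n.1, n.2 - 1) k

/-- divided power d^{(x)} of an operator d, for a K-valued exponent x
(zero unless x ∈ ℕ) -/
def dPow {A : Type*} [AddCommGroup A] [Module K A] (d : A → A) (x : K) (a : A) : A :=
  if h : ∃ j : ℕ, (j : K) = x then ((h.choose.factorial : K))⁻¹ • d^[h.choose] a else 0

/-- ∂_z^{(e_1)} ∂_z̄^{(e_2)} in the first variable pair -/
def ddPow2 (e : Idx K) (c : Dist2 K M) : Dist2 K M :=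
  dPow K (d1z K M) e.1 (dPow K (d1zb K M) e.2 c)

/-- the diagonal map c(𝐳,𝐰) ↦ c(𝐰,𝐰) -/
def diag (c : Dist2 K M) : Dist1 K M :=
  fun n => ∑ᶠ m : Idx K, c m (n.1 - m.1 - 1, n.2 - m.2 - 1)

/-- multiplication by (𝐳−𝐰)^h (expansion in z>w), on coefficients;
first index is 𝐳, second is 𝐰 -/
def zwPow (h : Idx K) (c : Dist2 K M) : Dist2 K M :=
  fun m k => ∑ᶠ i : ℕ × ℕ,
    ((-1 : K) ^ (i.1 + i.2) * gchoose K h.1 i.1 * gchoose K h.2 i.2) •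
      c (m.1 + h.1 - i.1, m.2 + h.2 - i.2) (k.1 + i.1, k.2 + i.2)

/-- multiplication by ((𝐳−𝐰)_{w>z})^h = (−1)^h (𝐰−𝐳)^h (expansion in w>z) -/
def zwPowW (h : Idx K) (c : Dist2 K M) : Dist2 K M :=
  fun m k => ∑ᶠ i : ℕ × ℕ,
    (negOnePow K (h.1 - h.2) * (-1 : K) ^ (i.1 + i.2) *
        gchoose K h.1 i.1 * gchoose K h.2 i.2) •
      c (m.1 + i.1, m.2 + i.2) (k.1 + h.1 - i.1, k.2 + h.2 - i.2)

/-- multiplication by (𝐱+𝐰)^N of a distribution d(𝐰,𝐱) (first index 𝐰, second 𝐱);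
the result is indexed by (x-index, w-index) -/
def xwPow (N : Idx K) (d : Dist2 K M) : Dist2 K M :=
  fun m k => ∑ᶠ i : ℕ × ℕ, (gchoose K N.1 i.1 * gchoose K N.2 i.2) •
    d (k.1 + i.1, k.2 + i.2) (m.1 + N.1 - i.1, m.2 + N.2 - i.2)

/-- multiplication by (𝐰+𝐱)^N of a distribution d(𝐰,𝐱) (first index 𝐰, second 𝐱);
the result is indexed by (x-index, w-index) -/
def wxPow (N : Idx K) (d : Dist2 K M) : Dist2 K M :=
  fun m k => ∑ᶠ i : ℕ × ℕ, (gchoose K N.1 i.1 * gchoose K N.2 i.2) •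
    d (k.1 + N.1 - i.1, k.2 + N.2 - i.2) (m.1 + i.1, m.2 + i.2)

/-- multiplication by 𝐱^A 𝐰^B (𝐱+𝐰)^N of p(𝐰,𝐱); result indexed (x-index, w-index) -/
def tripleXW (A B N : Idx K) (p : Dist2 K M) : Dist2 K M :=
  fun m k => ∑ᶠ l : ℕ × ℕ, (gchoose K N.1 l.1 * gchoose K N.2 l.2) •
    p (k.1 + B.1 + l.1, k.2 + B.2 + l.2) (m.1 + A.1 + N.1 - l.1, m.2 + A.2 + N.2 - l.2)

/-- multiplication by 𝐱^A 𝐰^B (𝐰+𝐱)^N of p(𝐰,𝐱); result indexed (x-index, w-index) -/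
def tripleWX (A B N : Idx K) (p : Dist2 K M) : Dist2 K M :=
  fun m k => ∑ᶠ l : ℕ × ℕ, (gchoose K N.1 l.1 * gchoose K N.2 l.2) •
    p (k.1 + B.1 + N.1 - l.1, k.2 + B.2 + N.2 - l.2) (m.1 + A.1 + l.1, m.2 + A.2 + l.2)

variable (E : Type*) [AddCommGroup E] [Module K E]

/-- End(E)-valued distributions in one variable pair -/
abbrev EDist1 := Dist1 K (Module.End K E)

/-- End(E)-valued distributions in two variable pairs -/
abbrev EDist2 := Dist2 K (Module.End K E)

/-- End(E)-valued distributions in r variable pairs -/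
abbrev EDistN (r : ℕ) := DistN K (Module.End K E) r

def ev1 (a : EDist1 K E) (v : E) : Dist1 K E := fun n => a n v

def ev2 (c : EDist2 K E) (v : E) : Dist2 K E := fun n k => c n k v

def evN {r : ℕ} (c : EDistN K E r) (v : E) : DistN K E r := fun n => c n v

/-- a(𝐳) is a field -/
def IsFieldD (a : EDist1 K E) : Prop := ∀ v, InLat1 K E (ev1 K E a v)

/-- a field in two variable pairs -/
def IsField2D (c : EDist2 K E) : Prop := ∀ v, InLat2 K E (ev2 K E c v)

/-- the Koszul sign (−1)^{pq} -/
def koszul (p q : ZMod 2) : K := if p = 1 ∧ q = 1 then (-1 : K) else 1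

/-- the data (c^i, 𝐡_i) is an OPE of the homogeneous distributions a(𝐳), b(𝐳)
of parities pa, pb (all identities to be read applied to each vector of E) -/
def IsOPE (pa pb : ZMod 2) (a b : EDist1 K E) {r : ℕ}
    (c : Fin r → EDist2 K E) (h : Fin r → Idx K) : Prop :=
  (∀ i, Kbar K (h i)) ∧ (∀ i, IsField2D K E (c i)) ∧
  (∀ v m k, a m (b k v) = ∑ i, zwPow K E (-(h i)) (ev2 K E (c i) v) m k) ∧
  (∀ v m k, koszul K pa pb • (b k (a m v)) =
      ∑ i, zwPowW K E (-(h i)) (ev2 K E (c i) v) m k)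

/-- a(𝐳), b(𝐳) (homogeneous of parities pa, pb) are local -/
def IsLocal (pa pb : ZMod 2) (a b : EDist1 K E) : Prop :=
  ∃ (r : ℕ) (c : Fin r → EDist2 K E) (h : Fin r → Idx K), IsOPE K E pa pb a b c h

/-- the exponents of an OPE are reduced: 𝐡_i ∉ 𝐡_j + ℤ² for i ≠ j -/
def ReducedExp {r : ℕ} (h : Fin r → Idx K) : Prop :=
  ∀ i j, i ≠ j → ¬ IsIntPair K (h i - h j)

/-- the product field a(𝐰)_{(𝐧)}b(𝐰) built from an OPE (c,h), applied to a vector v -/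
def prodAt {r : ℕ} (c : Fin r → EDist2 K E) (h : Fin r → Idx K) (n : Idx K)
    (v : E) : Dist1 K E :=
  fun m => ∑ i, diag K E
    (ddPow2 K E ((h i).1 - 1 - n.1, (h i).2 - 1 - n.2) (ev2 K E (c i) v)) m

/-- s₁ : a(𝐳) ↦ a_{(−1,−1)}1 -/
def s1 (one : E) (a : EDist1 K E) : E := a ((-1 : K), (-1 : K)) one

/-- the distribution d (to be thought of as a(𝐳)1) equals
Σ_{𝐢∈ℕ²} T^{(i)} T̄^{(ī)} (d_{(−1,−1)}) 𝐳^𝐢, i.e. a(𝐳) is creative -/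
def CreativeD (T Tb : Module.End K E) (d : Dist1 K E) : Prop :=
  (∀ i : ℕ × ℕ, d (-(i.1 : K) - 1, -(i.2 : K) - 1) =
      ((i.1.factorial : K)⁻¹ * (i.2.factorial : K)⁻¹) •
        ((T ^ i.1) * (Tb ^ i.2)) (d ((-1 : K), (-1 : K)))) ∧
  (∀ n : Idx K, (¬ ∃ i : ℕ × ℕ, n = (-(i.1 : K) - 1, -(i.2 : K) - 1)) → d n = 0)

/-- a(𝐳) is translation covariant for (T, T̄) -/
def TransCov (T Tb : Module.End K E) (a : EDist1 K E) : Prop :=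
  (∀ n : Idx K, T * a n - a n * T = (-n.1) • a (n.1 - 1, n.2)) ∧
  (∀ n : Idx K, Tb * a n - a n * Tb = (-n.2) • a (n.1, n.2 - 1))

/-- translation covariance of a product field, per vector -/
def TransCovAt (T Tb : Module.End K E) (P : E → Dist1 K E) : Prop :=
  (∀ v (m : Idx K), T (P v m) - P (T v) m = (-m.1) • P v (m.1 - 1, m.2)) ∧
  (∀ v (m : Idx K), Tb (P v m) - P (Tb v) m = (-m.2) • P v (m.1, m.2 - 1))

/-- the identity field 1(z) = id_E -/
def idField : EDist1 K E :=
  fun n => if n = ((-1 : K), (-1 : K)) then (1 : Module.End K E) else 0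

/-- pairs i < j in [r] -/
abbrev Pairs (r : ℕ) := {p : Fin r × Fin r // p.1 < p.2}

/-- the index shift of the i-th variable produced by the monomial of a binomial
expansion of ((𝐳_{p₁} − 𝐳_{p₂})_σ)^h belonging to 𝐤 ∈ ℕ² -/
def pairShift {r : ℕ} (p : Pairs r) (h : Idx K) (flip : Bool) (kk : ℕ × ℕ)
    (i : Fin r) : Idx K :=
  if i = p.1.1 then
    (if flip then ((kk.1 : K), (kk.2 : K)) else (h.1 - kk.1, h.2 - kk.2))
  else if i = p.1.2 then
    (if flip then (h.1 - kk.1, h.2 - kk.2) else ((kk.1 : K), (kk.2 : K)))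
  else 0

/-- the coefficient of a binomial expansion of ((𝐳_{p₁} − 𝐳_{p₂})_σ)^h
belonging to 𝐤 ∈ ℕ² -/
def pairCoef (h : Idx K) (flip : Bool) (kk : ℕ × ℕ) : K :=
  (if flip then negOnePow K (h.1 - h.2) else 1) * (-1 : K) ^ (kk.1 + kk.2) *
    gchoose K h.1 kk.1 * gchoose K h.2 kk.2

def flipOf {r : ℕ} (σ : Equiv.Perm (Fin r)) (p : Pairs r) : Bool :=
  decide (σ.symm p.1.2 < σ.symm p.1.1)

/-- multiplication by Π_{i<j} ((𝐳_i − 𝐳_j)_σ)^{h_{ij}} on an r-variable distribution -/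
def permMul {r : ℕ} (σ : Equiv.Perm (Fin r)) (hs : Pairs r → Idx K)
    (c : DistN K M r) : DistN K M r :=
  fun m => ∑ᶠ κ : Pairs r → ℕ × ℕ,
    (∏ p : Pairs r, pairCoef K (hs p) (flipOf σ p) (κ p)) •
      c (fun i => m i + ∑ p : Pairs r, pairShift K p (hs p) (flipOf σ p) (κ p) i)

/-- the Koszul sign ζ' produced by reordering a¹,…,aʳ into a^{σ1},…,a^{σr} -/
def koszulPerm {r : ℕ} (ps : Fin r → ZMod 2) (σ : Equiv.Perm (Fin r)) : K :=
  ∏ p : Pairs r,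
    if σ.symm p.1.2 < σ.symm p.1.1 ∧ ps p.1.1 = 1 ∧ ps p.1.2 = 1 then (-1 : K) else 1

/-- the composition a^{σ1}(𝐳_{σ1})_{m_{σ1}} ∘ ⋯ ∘ a^{σr}(𝐳_{σr})_{m_{σr}} applied to v -/
def compSeq {r : ℕ} (a : Fin r → EDist1 K E) (σ : Equiv.Perm (Fin r))
    (m : Fin r → Idx K) (v : E) : E :=
  (List.ofFn fun j : Fin r => σ j).foldr (fun i acc => a i (m i) acc) v

/-- the data (c^α, 𝐡_{ij}^k) is a (multiple) OPE of the homogeneous distributions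
a¹(𝐳),…,aʳ(𝐳) of parities ps -/
def IsMultOPE {r : ℕ} (a : Fin r → EDist1 K E) (ps : Fin r → ZMod 2)
    (rij : Fin r → Fin r → ℕ) (hs : ∀ i j : Fin r, Fin (rij i j) → Idx K)
    (c : ((p : Pairs r) → Fin (rij p.1.1 p.1.2)) → EDistN K E r) : Prop :=
  (∀ i j k, Kbar K (hs i j k)) ∧
  (∀ α v, InLatN K E (evN K E (c α) v)) ∧
  (∀ σ : Equiv.Perm (Fin r), ∀ v m,
    koszulPerm K ps σ • compSeq K E a σ m v =
      ∑ α : (p : Pairs r) → Fin (rij p.1.1 p.1.2),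
        permMul K E σ (fun p => -(hs p.1.1 p.1.2 (α p))) (evN K E (c α) v) m)

/-- a¹(𝐳),…,aʳ(𝐳) are multiply local -/
def MultiplyLocal {r : ℕ} (a : Fin r → EDist1 K E) (ps : Fin r → ZMod 2) : Prop :=
  ∃ (rij : Fin r → Fin r → ℕ) (hs : ∀ i j : Fin r, Fin (rij i j) → Idx K)
    (c : ((p : Pairs r) → Fin (rij p.1.1 p.1.2)) → EDistN K E r),
      IsMultOPE K E a ps rij hs c

/-- a set of homogeneous fields (with parities pF) is multiply local -/
def MultLocalSet (F : Set (EDist1 K E)) (pF : EDist1 K E → ZMod 2) : Prop :=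
  ∀ (r : ℕ) (f : Fin r → EDist1 K E), (∀ i, f i ∈ F) →
    MultiplyLocal K E f (fun i => pF (f i))

/-- a set of homogeneous fields (with parities pF) is uniformly local -/
def UnifLocalSet (F : Set (EDist1 K E)) (pF : EDist1 K E → ZMod 2) (one : E) : Prop :=
  ∃ (rr : EDist1 K E → EDist1 K E → ℕ)
    (hh : ∀ d e : EDist1 K E, Fin (rr d e) → Idx K),
    ∀ (r : ℕ) (f : Fin r → EDist1 K E), (∀ i, f i ∈ F) →
      ∃ c, IsMultOPE K E f (fun i => pF (f i)) (fun i j => rr (f i) (f j))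
          (fun i j => hh (f i) (f j)) c ∧
        ∀ α, IsPowN K E (evN K E (c α) one)

/-- a ∈ V is homogeneous of parity p w.r.t. the grading (ev, od) -/
def memPar {V : Type*} [AddCommGroup V] [Module K V] (ev od : Submodule K V)
    (a : V) (p : ZMod 2) : Prop :=
  (p = 0 ∧ a ∈ ev) ∨ (p = 1 ∧ a ∈ od)

/-- an endomorphism is homogeneous of parity p w.r.t. the grading (ev, od) -/
def EndPar {V : Type*} [AddCommGroup V] [Module K V] (ev od : Submodule K V)
    (f : Module.End K V) (p : ZMod 2) : Prop :=
  if p = 0 then (∀ v ∈ ev, f v ∈ ev) ∧ (∀ v ∈ od, f v ∈ od)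
  else (∀ v ∈ ev, f v ∈ od) ∧ (∀ v ∈ od, f v ∈ ev)

/-- a distribution is homogeneous of parity p -/
def EDistPar {V : Type*} [AddCommGroup V] [Module K V] (ev od : Submodule K V)
    (a : EDist1 K V) (p : ZMod 2) : Prop :=
  ∀ n, EndPar K ev od (a n) p

end OPEA

namespace OPEA

/-- an OPE-algebra -/
structure OPEAlg (K : Type*) [Field K] [CharZero K]
    (V : Type*) [AddCommGroup V] [Module K V] where
  ev : Submodule K V
  od : Submodule K V
  compl : IsCompl ev od
  Y : V →ₗ[K] EDist1 K V
  Y_par : ∀ a p, memPar K ev od a p → ∀ (n : Idx K) b q, memPar K ev od b q →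
    memPar K ev od (Y a n b) (p + q)
  one : V
  one_ev : one ∈ ev
  T : Module.End K V
  Tb : Module.End K V
  T_ev : EndPar K ev od T 0
  Tb_ev : EndPar K ev od Tb 0
  commTTb : T * Tb = Tb * T
  T_one : T one = 0
  Tb_one : Tb one = 0
  wcre : ∀ a, IsPow1 K V (ev1 K V (Y a) one)
  rid : ∀ a, Y a ((-1 : K), (-1 : K)) one = a
  tcov : ∀ a, TransCov K V T Tb (Y a)
  loc : ∀ a b pa pb, memPar K ev od a pa → memPar K ev od b pb →
    IsLocal K V pa pb (Y a) (Y b)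

/-- a bounded 𝕂̄-fold algebra -/
structure BFold (K : Type*) [Field K] [CharZero K]
    (V : Type*) [AddCommGroup V] [Module K V] where
  ev : Submodule K V
  od : Submodule K V
  compl : IsCompl ev od
  Y : V →ₗ[K] EDist1 K V
  Y_par : ∀ a p, memPar K ev od a p → ∀ (n : Idx K) b q, memPar K ev od b q →
    memPar K ev od (Y a n b) (p + q)
  fields : ∀ a, IsFieldD K V (Y a)
  bounded : ∀ a (n : Idx K), ¬ Kbar K n → ∀ b, Y a n b = 0

/-- a bounded 𝕂̄-fold module over a bounded 𝕂̄-fold algebra -/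
structure BMod (K : Type*) [Field K] [CharZero K]
    (V : Type*) [AddCommGroup V] [Module K V] (A : BFold K V)
    (Mo : Type*) [AddCommGroup Mo] [Module K Mo] where
  evM : Submodule K Mo
  odM : Submodule K Mo
  complM : IsCompl evM odM
  YM : V →ₗ[K] EDist1 K Mo
  YM_par : ∀ a p, memPar K A.ev A.od a p → ∀ n : Idx K, EndPar K evM odM (YM a n) p
  fieldsM : ∀ a, IsFieldD K Mo (YM a)
  boundedM : ∀ a (n : Idx K), ¬ Kbar K n → ∀ c, YM a n c = 0

variable (K : Type*) [Field K] [CharZero K]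
variable (V : Type*) [AddCommGroup V] [Module K V]
variable (Mo : Type*) [AddCommGroup Mo] [Module K Mo]

/-- the operator T₁ : a ↦ a_{(−2,−1)}1 of an OPE-algebra -/
def T1 (A : OPEAlg K V) : Module.End K V where
  toFun := fun a => A.Y a ((-2 : K), (-1 : K)) A.one
  map_add' := by
    intro x y
    simp [map_add, Pi.add_apply, LinearMap.add_apply]
  map_smul' := by
    intro c x
    simp [map_smul, Pi.smul_apply, LinearMap.smul_apply]

/-- the operator T̄₁ : a ↦ a_{(−1,−2)}1 of an OPE-algebra -/
def T1b (A : OPEAlg K V) : Module.End K V where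
  toFun := fun a => A.Y a ((-1 : K), (-2 : K)) A.one
  map_add' := by
    intro x y
    simp [map_add, Pi.add_apply, LinearMap.add_apply]
  map_smul' := by
    intro c x
    simp [map_smul, Pi.smul_apply, LinearMap.smul_apply]

/-- skew-symmetry for the pair (T, T̄) -/
def SkewSym (ev od : Submodule K V) (Yf : V → EDist1 K V)
    (T Tb : Module.End K V) : Prop :=
  ∀ a b pa pb, memPar K ev od a pa → memPar K ev od b pb →
    ∀ n : Idx K, Kbar K n →
      (Function.support (fun i : ℕ × ℕ =>
        ((i.1.factorial : K)⁻¹ * (i.2.factorial : K)⁻¹ *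
            negOnePow K (n.1 + i.1 - (n.2 + i.2))) •
          ((T ^ i.1) * (Tb ^ i.2)) (Yf a (n.1 + i.1, n.2 + i.2) b))).Finite ∧
      koszul K pa pb • Yf b n a =
        ∑ᶠ i : ℕ × ℕ, ((i.1.factorial : K)⁻¹ * (i.2.factorial : K)⁻¹ *
            negOnePow K (n.1 + i.1 - (n.2 + i.2))) •
          ((T ^ i.1) * (Tb ^ i.2)) (Yf a (n.1 + i.1, n.2 + i.2) b)

/-- (T, T̄) is a translation endomorphism of the module with state-field map YM -/
def TransEnd (YM : V → EDist1 K Mo) (T Tb : Module.End K V) : Prop :=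
  (∀ a (n : Idx K), YM (T a) n = (-n.1) • YM a (n.1 - 1, n.2)) ∧
  (∀ a (n : Idx K), YM (Tb a) n = (-n.2) • YM a (n.1, n.2 - 1))

/-- the coefficient at (x-index m, w-index k) of a(𝐱+𝐰) applied to the w-distribution bw -/
def lhsXW (YM : V → EDist1 K Mo) (a : V) (bw : Dist1 K Mo) (m k : Idx K) : Mo :=
  ∑ᶠ i : ℕ × ℕ, ((i.1.factorial : K)⁻¹ * (i.2.factorial : K)⁻¹) •
    (((dz K (Module.End K Mo))^[i.1] ((dzb K (Module.End K Mo))^[i.2] (YM a))) m)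
      (bw (k.1 + i.1, k.2 + i.2))

/-- a and cM are dual in the direct channel -/
def DualDirect (Y : V → EDist1 K V) (YM : V → EDist1 K Mo) (a : V) (cM : Mo) : Prop :=
  ∃ (s : ℕ) (d : Fin s → Idx K → Idx K → (V →ₗ[K] Mo)) (hj : Fin s → Idx K),
    (∀ j, Kbar K (hj j)) ∧
    (∀ j b, InLat2 K Mo (fun kw mx => d j kw mx b)) ∧
    (∀ b (m k : Idx K),
      lhsXW K V Mo YM a (fun k' => YM b k' cM) m k =
        ∑ j, xwPow K Mo (-(hj j)) (fun kw mx => d j kw mx b) m k) ∧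
    (∀ b (m k : Idx K),
      YM (Y a m b) k cM =
        ∑ j, wxPow K Mo (-(hj j)) (fun kw mx => d j kw mx b) m k)

/-- a and b are dual in the exchange channel on the module -/
def DualExch (Y : V → EDist1 K V) (YM : V → EDist1 K Mo) (a b : V) : Prop :=
  ∃ (r : ℕ) (hab : Fin r → Idx K), (∀ i, Kbar K (hab i)) ∧
    ∀ cM : Mo, ∃ (s : ℕ) (hac : Fin s → Idx K)
      (q : Fin r → Fin s → Idx K → Idx K → Mo),
      (∀ j, Kbar K (hac j)) ∧
      (∀ i j kw mx, q i j kw mx ≠ 0 → IsNegInt K mx.1 ∧ IsNegInt K mx.2) ∧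
      (∀ i j mx, InLat1 K Mo (fun kw => q i j kw mx)) ∧
      (∀ m k : Idx K,
        lhsXW K V Mo YM a (fun k' => YM b k' cM) m k =
          ∑ j, xwPow K Mo (-(hac j))
            (fun kw mx => ∑ i, q i j kw (mx.1 - (hab i).1, mx.2 - (hab i).2)) m k) ∧
      (∀ m k : Idx K,
        YM (Y a m b) k cM =
          ∑ j, wxPow K Mo (-(hac j))
            (fun kw mx => ∑ i, q i j kw (mx.1 - (hab i).1, mx.2 - (hab i).2)) m k)

/-- the module with state-field map YM is dual -/
def IsDualMod (ev od : Submodule K V) (Y : V → EDist1 K V) (YM : V → EDist1 K Mo) : Prop :=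
  ∃ (rVV : V → V → ℕ) (hVV : ∀ a b : V, Fin (rVV a b) → Idx K)
    (rVM : V → Mo → ℕ) (hVM : ∀ (a : V) (c : Mo), Fin (rVM a c) → Idx K),
    (∀ a b i, Kbar K (hVV a b i)) ∧ (∀ a c j, Kbar K (hVM a c j)) ∧
    ∀ a b pa pb, memPar K ev od a pa → memPar K ev od b pb → ∀ c : Mo,
      ∃ p : Fin (rVV a b) → Fin (rVM a c) → Fin (rVM b c) → Dist2 K Mo,
        (∀ i j k, IsPow2 K Mo (p i j k)) ∧
        (∀ m k : Idx K,
          lhsXW K V Mo YM a (fun k' => YM b k' c) m k =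
            ∑ i, ∑ j, ∑ kk, tripleXW K Mo (-(hVV a b i)) (-(hVM b c kk))
              (-(hVM a c j)) (p i j kk) m k) ∧
        (∀ m k : Idx K,
          YM (Y a m b) k c =
            ∑ i, ∑ j, ∑ kk, tripleWX K Mo (-(hVV a b i)) (-(hVM b c kk))
              (-(hVM a c j)) (p i j kk) m k)

/-- F_Y is multiply local -/
def MultLocalAlg (A : OPEAlg K V) : Prop :=
  ∀ (r : ℕ) (f : Fin r → V) (pf : Fin r → ZMod 2),
    (∀ i, memPar K A.ev A.od (f i) (pf i)) →
      MultiplyLocal K V (fun i => A.Y (f i)) pf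

/-- F_Y is uniformly local -/
def UnifLocalAlg (A : OPEAlg K V) : Prop :=
  ∃ (rr : V → V → ℕ) (hh : ∀ a b : V, Fin (rr a b) → Idx K),
    ∀ (r : ℕ) (f : Fin r → V) (pf : Fin r → ZMod 2),
      (∀ i, memPar K A.ev A.od (f i) (pf i)) →
        ∃ c, IsMultOPE K V (fun i => A.Y (f i)) pf (fun i j => rr (f i) (f j))
            (fun i j => hh (f i) (f j)) c ∧
          ∀ α, IsPowN K V (evN K V (c α) A.one)

end OPEA
namespace OPEA

/-! ### Signed binomial coefficients -/

/-- The coefficient of `u ^ x` in `(1 - u) ^ s`, for arbitrary `x s : K`. -/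
def signedChoose (K : Type*) [Field K] (x s : K) : K :=
  if h : ∃ j : ℕ, (j : K) = x then (-1 : K) ^ h.choose * gchoose K s h.choose else 0

section Scalars

variable {K : Type*} [Field K]

theorem signedChoose_eq_zero {x : K} (hx : ¬ ∃ j : ℕ, (j : K) = x) (s : K) :
    signedChoose K x s = 0 := by
  rw [signedChoose, dif_neg hx]

theorem gchoose_neg (s : K) (N : ℕ) :
    (-1 : K) ^ N * gchoose K s N = gchoose K (N - 1 - s) N := by
  have hc : (-1 : K) ^ N = ∏ _i ∈ Finset.range N, (-1 : K) := by
    rw [Finset.prod_const, Finset.card_range]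
  rw [gchoose, gchoose, ← Finset.prod_range_reflect, mul_div_assoc', hc,
    ← Finset.prod_mul_distrib]
  congr 1
  refine Finset.prod_congr rfl fun i hi => ?_
  have : i + 1 ≤ N := Finset.mem_range.1 hi
  rw [Nat.sub_sub, Nat.cast_sub (by omega)]
  push_cast
  ring

variable [CharZero K]

theorem signedChoose_natCast (j : ℕ) (s : K) :
    signedChoose K (j : K) s = (-1 : K) ^ j * gchoose K s j := by
  have h : ∃ i : ℕ, (i : K) = (j : K) := ⟨j, rfl⟩
  have h' : h.choose = j := Nat.cast_injective h.choose_spec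
  rw [signedChoose, dif_pos h, h']

theorem signedChoose_zero_left (s : K) : signedChoose K 0 s = 1 := by
  simpa [gchoose] using signedChoose_natCast (K := K) 0 s

theorem gchoose_succ (s : K) (j : ℕ) :
    ((j : K) + 1) * gchoose K s (j + 1) = (s - j) * gchoose K s j := by
  have h1 : ((j : K) + 1) ≠ 0 := by exact_mod_cast Nat.succ_ne_zero j
  have h2 : ((j.factorial : ℕ) : K) ≠ 0 := by exact_mod_cast j.factorial_ne_zero
  rw [gchoose, gchoose, Finset.prod_range_succ, Nat.factorial_succ]
  push_cast
  field_simp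

theorem gchoose_succ' (s : K) (j : ℕ) :
    ((j : K) + 1) * gchoose K (s + 1) (j + 1) = (s + 1) * gchoose K s j := by
  have h1 : ((j : K) + 1) ≠ 0 := by exact_mod_cast Nat.succ_ne_zero j
  have h2 : ((j.factorial : ℕ) : K) ≠ 0 := by exact_mod_cast j.factorial_ne_zero
  rw [gchoose, gchoose, Finset.prod_range_succ', Nat.factorial_succ]
  have : ∀ i : ℕ, s + 1 - ((i + 1 : ℕ) : K) = s - i := fun i => by push_cast; ring
  simp only [this]
  push_cast
  field_simp
  ring

theorem gchoose_pascal (s : K) (j : ℕ) :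
    gchoose K (s + 1) (j + 1) = gchoose K s (j + 1) + gchoose K s j := by
  have h1 : ((j : K) + 1) ≠ 0 := by exact_mod_cast Nat.succ_ne_zero j
  apply mul_left_cancel₀ h1
  rw [gchoose_succ', mul_add, gchoose_succ]
  ring

theorem signedChoose_add_one (x s : K) :
    signedChoose K x (s + 1) = signedChoose K x s - signedChoose K (x - 1) s := by
  by_cases hx : ∃ j : ℕ, (j : K) = x
  · obtain ⟨j, rfl⟩ := hx
    cases j with
    | zero =>
      have : ¬ ∃ i : ℕ, (i : K) = ((0 : ℕ) : K) - 1 := by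
        rintro ⟨i, hi⟩
        have : ((i + 1 : ℕ) : K) = ((0 : ℕ) : K) := by push_cast at hi ⊢; linear_combination hi
        exact absurd (Nat.cast_injective this) (Nat.succ_ne_zero i)
      rw [signedChoose_eq_zero this]
      simp [signedChoose_zero_left]
    | succ j =>
      have : (((j + 1 : ℕ) : K)) - 1 = (j : K) := by push_cast; ring
      rw [this, signedChoose_natCast, signedChoose_natCast, signedChoose_natCast, gchoose_pascal]
      ring
  · have hx' : ¬ ∃ j : ℕ, (j : K) = x - 1 := by
      rintro ⟨j, hj⟩
      exact hx ⟨j + 1, by push_cast; rw [hj]; ring⟩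
    simp [signedChoose_eq_zero hx, signedChoose_eq_zero hx']

theorem signedChoose_succ_neg (j : ℕ) (g : K) :
    ((j : K) + 1) * signedChoose K ((j + 1 : ℕ) : K) (-g) =
      (g + j) * signedChoose K (j : K) (-g) := by
  rw [signedChoose_natCast, signedChoose_natCast, pow_succ]
  linear_combination (-(-1 : K) ^ j) * gchoose_succ (-g) j

theorem gchoose_eq_choose (s : K) (j : ℕ) : gchoose K s j = Ring.choose s j := by
  rw [Ring.choose_eq_smul, gchoose, ← descPochhammer_eval_eq_prod_range,
    ← Polynomial.aeval_eq_smeval, Polynomial.aeval_def, ← Polynomial.eval_map,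
    descPochhammer_map, div_eq_inv_mul, smul_eq_mul]

theorem gchoose_add (r s : K) (N : ℕ) :
    gchoose K (r + s) N =
      ∑ ij ∈ Finset.HasAntidiagonal.antidiagonal N, gchoose K r ij.1 * gchoose K s ij.2 := by
  simp only [gchoose_eq_choose]
  exact Ring.add_choose_eq N (Commute.all r s)

theorem negOnePow_intCast (z : ℤ) : negOnePow K (z : K) = (-1 : K) ^ z := by
  have h : ∃ k : ℤ, (k : K) = (z : K) := ⟨z, rfl⟩
  have h' : h.choose = z := Int.cast_injective h.choose_spec
  rw [negOnePow, dif_pos h, h']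

theorem negOnePow_natCast (N : ℕ) : negOnePow K (N : K) = (-1 : K) ^ N := by
  rw [← Int.cast_natCast, negOnePow_intCast, zpow_natCast]

/-- The scalar form of `∂_w^{(e)} = ∑ (-1)^{e-i} ∂^{(i)} ∂_z^{(e-i)}` on the diagonal. -/
theorem sum_signedChoose_mul (e m y : K) (M : ℕ) (hM : ∀ N : ℕ, (N : K) = e → N < M) :
    ∑ i ∈ Finset.range M, (-1 : K) ^ i *
        (signedChoose K (i : K) m * signedChoose K (e - i) (m - i - 1 - y)) =
      negOnePow K e * signedChoose K e (y + e) := by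
  by_cases he : ∃ N : ℕ, (N : K) = e
  · obtain ⟨N, rfl⟩ := he
    have hN := hM N rfl
    rw [← Finset.sum_subset (Finset.range_subset_range.2 (Nat.succ_le_of_lt hN)),
      signedChoose_natCast, negOnePow_natCast, ← mul_assoc, ← mul_pow, neg_one_mul, neg_neg,
      one_pow, one_mul, show y + (N : K) = m + (y + N - m) by ring, gchoose_add,
      Finset.Nat.sum_antidiagonal_eq_sum_range_succ_mk]
    · refine Finset.sum_congr rfl fun i hi => ?_
      have hi' : i ≤ N := Nat.lt_succ_iff.1 (Finset.mem_range.1 hi)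
      rw [← Nat.cast_sub hi', signedChoose_natCast, signedChoose_natCast,
        gchoose_neg (m - i - 1 - y),
        Nat.cast_sub hi', ← mul_assoc, ← mul_assoc, ← mul_pow, neg_one_mul, neg_neg, one_pow,
        one_mul]
      congr 2
      ring
    · intro i _ hi
      have hi' : N < i := by simpa [Nat.lt_succ_iff] using hi
      rw [signedChoose_eq_zero (x := (N : K) - i), mul_zero, mul_zero]
      rintro ⟨j, hj⟩
      have : ((j + i : ℕ) : K) = N := by push_cast; rw [hj]; ring
      have := Nat.cast_injective this
      omega
  · rw [signedChoose_eq_zero he, mul_zero]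
    refine Finset.sum_eq_zero fun i _ => ?_
    rw [signedChoose_eq_zero (x := e - i), mul_zero, mul_zero]
    rintro ⟨j, hj⟩
    exact he ⟨j + i, by push_cast; rw [hj]; ring⟩

end Scalars

/-! ### Independence of the functions `t ^ y * (1 - t) ^ (-g)` -/

section Independence

variable {K : Type*} [Field K]

/-- The backward difference operator on functions `K → K`. -/
def backDiff (K : Type*) [Field K] : Module.End K (K → K) where
  toFun φ g := φ g - φ (g - 1)
  map_add' φ ψ := by ext g; simp only [Pi.add_apply]; ring
  map_smul' c φ := by
    ext g; simp only [Pi.smul_apply, smul_eq_mul, RingHom.id_apply]; ring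

theorem backDiff_apply (φ : K → K) (g : K) : backDiff K φ g = φ g - φ (g - 1) := rfl

theorem backDiff_pow_succ_apply (l : ℕ) (φ : K → K) (g : K) :
    (backDiff K ^ (l + 1)) φ g = (backDiff K ^ l) φ g - (backDiff K ^ l) φ (g - 1) := by
  rw [pow_succ', Module.End.mul_apply, backDiff_apply]

theorem backDiff_pow_congr {φ ψ : K → K} (l : ℕ) (g : K)
    (h : ∀ q ≤ l, φ (g - (q : ℕ)) = ψ (g - (q : ℕ))) :
    (backDiff K ^ l) φ g = (backDiff K ^ l) ψ g := by
  induction l generalizing g with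
  | zero => simpa using h 0 le_rfl
  | succ l ih =>
    rw [backDiff_pow_succ_apply, backDiff_pow_succ_apply, ih g fun q hq => h q (by omega),
      ih (g - 1) fun q hq => ?_]
    have := h (q + 1) (by omega)
    push_cast at this
    rwa [sub_add_eq_sub_sub_swap] at this

variable [CharZero K]

theorem backDiff_pow_signedChoose_neg (x : K) (l : ℕ) (g : K) :
    (backDiff K ^ l) (fun g => signedChoose K x (-g)) g = signedChoose K (x - l) (-g) := by
  induction l generalizing g with
  | zero => simp
  | succ l ih =>
    have h := signedChoose_add_one (x - l) (-g)
    rw [backDiff_pow_succ_apply, ih, ih, neg_sub', sub_neg_eq_add, h]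
    push_cast
    rw [← sub_sub]
    ring

theorem backDiff_pow_signedChoose_sub (n s : K) (l : ℕ) (g : K) :
    (backDiff K ^ l) (fun g => signedChoose K (g - 1 - n) s) g =
      signedChoose K (g - 1 - n) (s + l) := by
  induction l generalizing g with
  | zero => simp
  | succ l ih =>
    rw [backDiff_pow_succ_apply, ih, ih]
    push_cast
    rw [← add_assoc, signedChoose_add_one]
    congr 2
    ring

variable {E : Type*} [AddCommGroup E] [Module K E] {ι : Type*}

theorem sum_signedChoose_smul_eq_zero_of_nat (I : Finset ι) (g : ι → K) (l : ι → ℕ) (F : ι → E)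
    (hF : ∀ j : ℕ, ∑ x ∈ I, signedChoose K ((j : K) - l x) (-g x) • F x = 0) (n s : K) :
    ∑ x ∈ I, signedChoose K (g x - 1 - n) (s + l x) • F x = 0 := by
  let W : (K → K) →ₗ[K] E :=
    ∑ x ∈ I, LinearMap.toSpanSingleton K E (F x) ∘ₗ LinearMap.proj (g x) ∘ₗ (backDiff K ^ l x)
  have hW : ∀ φ, W φ = ∑ x ∈ I, (backDiff K ^ l x) φ (g x) • F x := fun φ => by
    simp [W, LinearMap.sum_apply]
  have hbase : ∀ N j : ℕ, W (fun g => g ^ N * signedChoose K (j : K) (-g)) = 0 := by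
    intro N
    induction N with
    | zero =>
      intro j
      simp only [pow_zero, one_mul, hW, backDiff_pow_signedChoose_neg, hF]
    | succ N ih =>
      intro j
      have : (fun g : K => g ^ (N + 1) * signedChoose K (j : K) (-g)) =
          ((j : K) + 1) • (fun g => g ^ N * signedChoose K ((j + 1 : ℕ) : K) (-g)) -
            (j : K) • (fun g => g ^ N * signedChoose K (j : K) (-g)) := by
        ext g
        simp only [Pi.sub_apply, Pi.smul_apply, smul_eq_mul]
        linear_combination (-g ^ N) * signedChoose_succ_neg j g
      rw [this, map_sub, map_smul, map_smul, ih, ih, smul_zero, smul_zero, sub_zero]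
  have hpoly : ∀ p : Polynomial K, W (fun g => p.eval g) = 0 := by
    intro p
    induction p using Polynomial.induction_on' with
    | add p q hp hq =>
      have : (fun g => (p + q).eval g) = (fun g => p.eval g) + fun g => q.eval g := by
        ext g; simp
      rw [this, map_add, hp, hq, add_zero]
    | monomial N c =>
      have : (fun g => (Polynomial.monomial N c).eval g) =
          c • fun g => g ^ N * signedChoose K ((0 : ℕ) : K) (-g) := by
        ext g; simp [signedChoose_zero_left]
      rw [this, map_smul, hbase, smul_zero]
  let A : Finset K := I.biUnion fun x => (Finset.range (l x + 1)).image fun q => g x - (q : ℕ)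
  let p := Lagrange.interpolate A id fun g => signedChoose K (g - 1 - n) s
  have hp : ∀ α ∈ A, p.eval α = signedChoose K (α - 1 - n) s := fun α hα =>
    Lagrange.eval_interpolate_at_node (v := id) _ Function.injective_id.injOn hα
  rw [← hpoly p, hW]
  refine Finset.sum_congr rfl fun x hx => ?_
  rw [← backDiff_pow_signedChoose_sub]
  congr 1
  refine backDiff_pow_congr _ _ fun q hq => (hp _ ?_).symm
  exact Finset.mem_biUnion.2 ⟨x, hx, Finset.mem_image.2 ⟨q, by simpa [Nat.lt_succ_iff], rfl⟩⟩

theorem sum_signedChoose_smul_eq_zero (I : Finset ι) (g y : ι → K) (F : ι → E)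
    (hF : ∀ k : K, ∑ x ∈ I, signedChoose K (y x - k) (-g x) • F x = 0) (n m : K) :
    ∑ x ∈ I, signedChoose K (g x - 1 - n) (m - 1 - y x) • F x = 0 := by
  let R := (Int.castAddHom K).range
  rw [← Finset.sum_fiberwise_of_maps_to (t := I.image fun x => (y x : K ⧸ R))
    (g := fun x => (y x : K ⧸ R)) (fun x hx => Finset.mem_image_of_mem _ hx)]
  refine Finset.sum_eq_zero fun q hq => ?_
  obtain ⟨x₀, -, rfl⟩ := Finset.mem_image.1 hq
  set J := I.filter fun x => (y x : K ⧸ R) = (y x₀ : K ⧸ R) with hJ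
  have hz : ∀ x, ∃ z : ℤ, x ∈ J → y x = y x₀ - z := by
    intro x
    by_cases hx : x ∈ J
    · have h := (Finset.mem_filter.1 hx).2
      obtain ⟨z, hz⟩ := QuotientAddGroup.eq.1 h
      refine ⟨z, fun _ => ?_⟩
      have hz' : (z : K) = -y x + y x₀ := hz
      rw [hz']; ring
    · exact ⟨0, fun h => absurd h hx⟩
  choose z hz using hz
  obtain ⟨N, hN⟩ : ∃ N : ℕ, ∀ x ∈ J, 0 ≤ z x + N := by
    refine ⟨∑ x ∈ J, (z x).natAbs, fun x hx => ?_⟩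
    have : (z x).natAbs ≤ ∑ x ∈ J, (z x).natAbs :=
      Finset.single_le_sum (f := fun x => (z x).natAbs) (fun _ _ => Nat.zero_le _) hx
    omega
  have hl : ∀ x ∈ J, y x = y x₀ + N - ((z x + N).toNat : ℕ) := by
    intro x hx
    have h1 : (((z x + N).toNat : ℤ) : K) = ((z x + N : ℤ) : K) := by
      rw [Int.toNat_of_nonneg (hN x hx)]
    rw [hz x hx]
    push_cast at h1
    rw [h1]; ring
  have key := sum_signedChoose_smul_eq_zero_of_nat J g (fun x => (z x + N).toNat) F
    (fun j => ?_) n (m - 1 - (y x₀ + N))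
  · rw [← key]
    refine Finset.sum_congr rfl fun x hx => ?_
    congr 2
    rw [hl x hx]; ring
  · rw [← hF (y x₀ + N - j)]
    symm
    rw [← Finset.sum_subset (Finset.filter_subset (fun x => (y x : K ⧸ R) = (y x₀ : K ⧸ R)) I)]
    · refine Finset.sum_congr rfl fun x hx => ?_
      congr 2
      rw [hl x hx]; ring
    · intro x hx hxJ
      rw [signedChoose_eq_zero, zero_smul]
      rintro ⟨i, hi⟩
      refine hxJ (Finset.mem_filter.2 ⟨hx, QuotientAddGroup.eq.2 ⟨(j : ℤ) - i - N, ?_⟩⟩)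
      rw [Int.coe_castAddHom]
      push_cast
      rw [hi]; ring

theorem sum_signedChoose_smul_eq_zero₂ (I : Finset ι) (g y : ι → Idx K) (F : ι → E)
    (hF : ∀ k : Idx K, ∑ x ∈ I, (signedChoose K ((y x).1 - k.1) (-(g x).1) *
      signedChoose K ((y x).2 - k.2) (-(g x).2)) • F x = 0) (n m : Idx K) :
    ∑ x ∈ I, (signedChoose K ((g x).1 - 1 - n.1) (m.1 - 1 - (y x).1) *
      signedChoose K ((g x).2 - 1 - n.2) (m.2 - 1 - (y x).2)) • F x = 0 := by
  have h₁ : ∀ k₂ : K, ∑ x ∈ I, signedChoose K ((g x).1 - 1 - n.1) (m.1 - 1 - (y x).1) •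
      signedChoose K ((y x).2 - k₂) (-(g x).2) • F x = 0 := fun k₂ =>
    sum_signedChoose_smul_eq_zero I (fun x => (g x).1) (fun x => (y x).1) _
      (fun k₁ => by simpa only [mul_smul] using hF (k₁, k₂)) n.1 m.1
  have h₂ := sum_signedChoose_smul_eq_zero I (fun x => (g x).2) (fun x => (y x).2)
    (fun x => signedChoose K ((g x).1 - 1 - n.1) (m.1 - 1 - (y x).1) • F x)
    (fun k₂ => (Finset.sum_congr rfl fun x _ => smul_comm _ _ _).trans (h₁ k₂)) n.2 m.2
  rw [← h₂]
  exact Finset.sum_congr rfl fun x _ => by rw [mul_smul, smul_comm]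

end Independence

/-! ### Coefficients of products and of diagonals -/

section Coefficients

variable {K : Type*} [Field K] {E : Type*} [AddCommGroup E]

theorem finite_isNegInt_inter [CharZero K] (p q t : K) :
    {x : K | IsNegInt K (t - x - p) ∧ IsNegInt K (x - q)}.Finite := by
  by_cases h : ∃ N : ℤ, (N : K) = t - p - q
  · obtain ⟨N, hN⟩ := h
    refine ((Set.finite_Ioo N 0).image fun b : ℤ => q + (b : K)).subset ?_
    rintro x ⟨⟨a, ha, hax⟩, ⟨b, hb, hbx⟩⟩
    refine ⟨b, ⟨?_, hb⟩, by simp only [hbx]; ring⟩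
    have : ((a + b : ℤ) : K) = (N : K) := by push_cast; rw [hN, hax, hbx]; ring
    have := Int.cast_injective this
    omega
  · convert Set.finite_empty
    refine Set.eq_empty_of_forall_notMem ?_
    rintro x ⟨⟨a, ha, hax⟩, ⟨b, hb, hbx⟩⟩
    exact h ⟨a + b, by push_cast; rw [hax, hbx]; ring⟩

/-- A distribution in `E⌊𝐳,𝐰⌋` has only finitely many coefficients of a given total degree. -/
theorem InLat2.finite_setOf_ne_zero [CharZero K] {d : Dist2 K E} (hd : InLat2 K E d) (T : Idx K) :
    {y : Idx K | d (T - y) y ≠ 0}.Finite := by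
  obtain ⟨S, hS⟩ := hd
  refine (S.finite_toSet.biUnion fun p _ =>
    (finite_isNegInt_inter p.1.1 p.2.1 T.1).prod
      (finite_isNegInt_inter p.1.2 p.2.2 T.2)).subset fun y hy => ?_
  obtain ⟨p, hp, ⟨h1, h2⟩, h3, h4⟩ := hS _ _ hy
  exact Set.mem_biUnion hp ⟨⟨h1, h3⟩, ⟨h2, h4⟩⟩

theorem InLat2.swap {c : Dist2 K E} (hc : InLat2 K E c) : InLat2 K E fun x y => c y x := by
  obtain ⟨S, hS⟩ := hc
  refine ⟨S.image Prod.swap, fun n k hnk => ?_⟩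
  obtain ⟨p, hp, h1, h2⟩ := hS k n hnk
  exact ⟨p.swap, Finset.mem_image_of_mem _ hp, h2, h1⟩

variable [Module K E]

theorem InLat2.smul {c : Dist2 K E} (hc : InLat2 K E c) (x : K) : InLat2 K E (x • c) := by
  obtain ⟨S, hS⟩ := hc
  exact ⟨S, fun n k hnk => hS n k (right_ne_zero_of_smul hnk)⟩

theorem zwPow_smul (g : Idx K) (c : Dist2 K E) (x : K) (m k : Idx K) :
    zwPow K E g (x • c) m k = x • zwPow K E g c m k := by
  rw [zwPow, zwPow, smul_finsum]
  exact finsum_congr fun i => smul_comm _ _ _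

theorem zwPowW_eq (g : Idx K) (c : Dist2 K E) (m k : Idx K) :
    zwPowW K E g c m k = negOnePow K (g.1 - g.2) • zwPow K E g (fun x y => c y x) k m := by
  rw [zwPowW, zwPow, smul_finsum]
  exact finsum_congr fun i => by rw [smul_smul, mul_assoc, mul_assoc, mul_assoc]

variable [CharZero K]

theorem zwPow_eq_sum (g : Idx K) (d : Dist2 K E) (T k : Idx K) (S : Finset (Idx K))
    (hS : ∀ y, d (T - g - y) y ≠ 0 → y ∈ S) :
    zwPow K E (-g) d (T - k) k =
      ∑ y ∈ S, (signedChoose K (y.1 - k.1) (-g.1) * signedChoose K (y.2 - k.2) (-g.2)) •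
        d (T - g - y) y := by
  let f : Idx K → E := fun y =>
    (signedChoose K (y.1 - k.1) (-g.1) * signedChoose K (y.2 - k.2) (-g.2)) • d (T - g - y) y
  let emb : ℕ × ℕ → Idx K := fun i => (k.1 + i.1, k.2 + i.2)
  have hemb : Function.Injective emb := by
    rintro ⟨i₁, i₂⟩ ⟨j₁, j₂⟩ hij
    simpa [emb] using hij
  have h1 : zwPow K E (-g) d (T - k) k = ∑ᶠ i, f (emb i) := by
    refine finsum_congr fun i => ?_
    simp only [f, emb, add_sub_cancel_left, signedChoose_natCast]
    congr 1
    · rw [pow_add, Prod.fst_neg, Prod.snd_neg]; ring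
    · congr 1
      ext <;> simp <;> ring
  have h2 : f.support ⊆ Set.range emb := by
    intro y hy
    have h : ∀ {x s : K}, signedChoose K x s ≠ 0 → ∃ j : ℕ, (j : K) = x := fun hx =>
      not_not.1 fun h => hx (signedChoose_eq_zero h _)
    have hy' := left_ne_zero_of_smul hy
    obtain ⟨i, hi⟩ := h (left_ne_zero_of_mul hy')
    obtain ⟨j, hj⟩ := h (right_ne_zero_of_mul hy')
    exact ⟨(i, j), Prod.ext (by simp [emb, hi]) (by simp [emb, hj])⟩
  rw [h1, ← finsum_mem_range hemb, finsum_mem_def, Set.indicator_eq_self.2 h2]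
  exact finsum_eq_sum_of_support_subset f fun y hy => hS y (right_ne_zero_of_smul hy)

theorem inv_factorial_smul_iterate_apply {A : Type*} {d : (A → E) → A → E} {coord : A → K}
    {shift : K → A → A} (hshift : ∀ x y a, shift x (shift y a) = shift (x + y) a)
    (hzero : ∀ a, shift 0 a = a) (hcoord : ∀ x a, coord (shift x a) = coord a - x)
    (hd : ∀ f a, d f a = (-coord a) • f (shift 1 a)) (j : ℕ) (f : A → E) (a : A) :
    (j.factorial : K)⁻¹ • d^[j] f a = signedChoose K (j : K) (coord a) • f (shift j a) := by
  induction j generalizing f with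
  | zero => simp [signedChoose_zero_left, hzero]
  | succ j ih =>
    have h1 : ((j : K) + 1) ≠ 0 := by exact_mod_cast Nat.succ_ne_zero j
    rw [Function.iterate_succ_apply, Nat.factorial_succ, Nat.cast_mul, mul_inv, mul_smul, ih (d f),
      hd, hshift, hcoord, smul_smul, smul_smul]
    congr 1
    · rw [signedChoose_natCast, signedChoose_natCast, pow_succ, Nat.cast_succ]
      field_simp
      linear_combination gchoose_succ (coord a) j
    · congr 2
      push_cast
      ring

theorem dz_iterate_apply (j : ℕ) (f : Dist1 K E) (n : Idx K) :
    (j.factorial : K)⁻¹ • (dz K E)^[j] f n = signedChoose K (j : K) n.1 • f (n.1 - j, n.2) :=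
  inv_factorial_smul_iterate_apply (coord := Prod.fst) (shift := fun x n => (n.1 - x, n.2))
    (fun x y n => by simp only [sub_sub, add_comm]) (fun n => by simp) (fun _ _ => rfl)
    (fun _ _ => rfl) j f n

theorem dzb_iterate_apply (j : ℕ) (f : Dist1 K E) (n : Idx K) :
    (j.factorial : K)⁻¹ • (dzb K E)^[j] f n = signedChoose K (j : K) n.2 • f (n.1, n.2 - j) :=
  inv_factorial_smul_iterate_apply (coord := Prod.snd) (shift := fun x n => (n.1, n.2 - x))
    (fun x y n => by simp only [sub_sub, add_comm]) (fun n => by simp) (fun _ _ => rfl)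
    (fun _ _ => rfl) j f n

theorem dz_dzb_iterate_apply (i : ℕ × ℕ) (f : Dist1 K E) (m : Idx K) :
    ((i.1.factorial : K)⁻¹ * (i.2.factorial : K)⁻¹) • (dz K E)^[i.1] ((dzb K E)^[i.2] f) m =
      (signedChoose K (i.1 : K) m.1 * signedChoose K (i.2 : K) m.2) •
        f (m.1 - i.1, m.2 - i.2) := by
  rw [mul_comm, mul_smul, dz_iterate_apply, smul_comm, dzb_iterate_apply, mul_smul]

theorem ddPow2_apply (e : Idx K) (c : Dist2 K E) (n k : Idx K) :
    ddPow2 K E e c n k =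
      (signedChoose K e.1 n.1 * signedChoose K e.2 n.2) • c (n - e) k := by
  have h : ∀ (x : K) (c : Dist2 K E) (n k : Idx K),
      dPow K (d1z K E) x c n k = signedChoose K x n.1 • c (n.1 - x, n.2) k := by
    intro x c n k
    by_cases hx : ∃ j : ℕ, (j : K) = x
    · have := congrFun (dz_iterate_apply (E := Idx K → E) hx.choose c n) k
      rw [hx.choose_spec] at this
      rw [dPow, dif_pos hx]
      exact this
    · rw [dPow, dif_neg hx, signedChoose_eq_zero hx, zero_smul]; rfl
  have hb : ∀ (x : K) (c : Dist2 K E) (n k : Idx K),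
      dPow K (d1zb K E) x c n k = signedChoose K x n.2 • c (n.1, n.2 - x) k := by
    intro x c n k
    by_cases hx : ∃ j : ℕ, (j : K) = x
    · have := congrFun (dzb_iterate_apply (E := Idx K → E) hx.choose c n) k
      rw [hx.choose_spec] at this
      rw [dPow, dif_pos hx]
      exact this
    · rw [dPow, dif_neg hx, signedChoose_eq_zero hx, zero_smul]; rfl
  rw [ddPow2, h, hb, mul_smul]
  rfl

theorem diag_ddPow2 (e : Idx K) (c : Dist2 K E) (m : Idx K) (S : Finset (Idx K))
    (hS : ∀ y, c (m - 1 - e - y) y ≠ 0 → y ∈ S) :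
    diag K E (ddPow2 K E e c) m =
      ∑ y ∈ S, (signedChoose K e.1 (m.1 - 1 - y.1) * signedChoose K e.2 (m.2 - 1 - y.2)) •
        c (m - 1 - e - y) y := by
  rw [diag, ← finsum_comp_equiv (Equiv.subLeft (m - 1))]
  have : ∀ y, ddPow2 K E e c (Equiv.subLeft (m - 1) y) (m.1 - (Equiv.subLeft (m - 1) y).1 - 1,
      m.2 - (Equiv.subLeft (m - 1) y).2 - 1) =
      (signedChoose K e.1 (m.1 - 1 - y.1) * signedChoose K e.2 (m.2 - 1 - y.2)) •
        c (m - 1 - e - y) y := by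
    intro y
    rw [ddPow2_apply]
    congr 2
    · simp only [Equiv.subLeft_apply]; abel
    · ext <;> simp [sub_right_comm]
  simp only [this]
  exact finsum_eq_sum_of_support_subset _ fun y hy => hS y (right_ne_zero_of_smul hy)

/-- If `∑ (𝐳 - 𝐰)^{-𝐠} d` vanishes, so does every coefficient of its expansion around `𝐳 = 𝐰`. -/
theorem sum_diag_ddPow2_eq_zero {ι : Type*} [Fintype ι] (g : ι → Idx K) (d : ι → Dist2 K E)
    (hd : ∀ i, InLat2 K E (d i)) (h : ∀ m k, ∑ i, zwPow K E (-(g i)) (d i) m k = 0)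
    (n m : Idx K) :
    ∑ i, diag K E (ddPow2 K E ((g i).1 - 1 - n.1, (g i).2 - 1 - n.2) (d i)) m = 0 := by
  let S : Finset (Idx K) := Finset.univ.biUnion fun i =>
    ((hd i).finite_setOf_ne_zero (m + n - g i)).toFinset
  have hS : ∀ i y, d i (m + n - g i - y) y ≠ 0 → y ∈ S := fun i y hy =>
    Finset.mem_biUnion.2 ⟨i, Finset.mem_univ i, (Set.Finite.mem_toFinset _).2 hy⟩
  have key := sum_signedChoose_smul_eq_zero₂ (Finset.univ ×ˢ S) (fun x : ι × Idx K => g x.1)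
    (fun x => x.2) (fun x => d x.1 (m + n - g x.1 - x.2) x.2) (fun k => ?_) n m
  · rw [← key, Finset.sum_product]
    refine Finset.sum_congr rfl fun i _ => ?_
    have he : m - 1 - ((g i).1 - 1 - n.1, (g i).2 - 1 - n.2) = m + n - g i := by
      ext <;> simp <;> ring
    rw [diag_ddPow2 _ _ _ S fun y hy => hS i y (by rwa [he] at hy), he]
  · rw [← h (m + n - k) k, Finset.sum_product]
    exact Finset.sum_congr rfl fun i _ => (zwPow_eq_sum _ _ _ _ S (hS i)).symm

theorem diag_ddPow2_smul (e : Idx K) (c : Dist2 K E) (x : K) (m : Idx K) :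
    diag K E (ddPow2 K E e (x • c)) m = x • diag K E (ddPow2 K E e c) m := by
  rw [diag, diag, smul_finsum]
  refine finsum_congr fun i => ?_
  rw [ddPow2_apply, ddPow2_apply, Pi.smul_apply, Pi.smul_apply, smul_comm]

/-- The diagonal value of `∂_w^{(𝐞)}` in terms of those of `∂_z^{(𝐞 - 𝐢)}`. -/
theorem negOnePow_smul_diag_ddPow2_swap (e : Idx K) (c : Dist2 K E) (hc : InLat2 K E c)
    (m : Idx K) (M : ℕ) (hM₁ : ∀ N : ℕ, (N : K) = e.1 → N < M)
    (hM₂ : ∀ N : ℕ, (N : K) = e.2 → N < M) :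
    (negOnePow K e.1 * negOnePow K e.2) • diag K E (ddPow2 K E e fun x y => c y x) m =
      ∑ i ∈ Finset.range M ×ˢ Finset.range M, ((-1 : K) ^ (i.1 + i.2) *
        (signedChoose K (i.1 : K) m.1 * signedChoose K (i.2 : K) m.2)) •
          diag K E (ddPow2 K E (e.1 - i.1, e.2 - i.2) c) (m.1 - i.1, m.2 - i.2) := by
  set S := (hc.finite_setOf_ne_zero (m - 1 - e)).toFinset with hS
  have hmem : ∀ y, c (m - 1 - e - y) y ≠ 0 → y ∈ S := fun y hy =>
    (Set.Finite.mem_toFinset _).2 hy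
  have hL := diag_ddPow2 e (fun x y => c y x) m (S.image fun y => m - 1 - e - y)
    fun y hy => Finset.mem_image.2 ⟨m - 1 - e - y, hmem _ (by simpa using hy), by simp⟩
  have hidx : ∀ i : ℕ × ℕ,
      ((m.1 - i.1, m.2 - i.2) : Idx K) - 1 - (e.1 - i.1, e.2 - i.2) = m - 1 - e := by
    intro i; ext <;> simp <;> ring
  have hR : ∀ i : ℕ × ℕ,
      diag K E (ddPow2 K E (e.1 - i.1, e.2 - i.2) c) (m.1 - i.1, m.2 - i.2) =
        ∑ y ∈ S, (signedChoose K (e.1 - i.1) (m.1 - i.1 - 1 - y.1) *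
          signedChoose K (e.2 - i.2) (m.2 - i.2 - 1 - y.2)) • c (m - 1 - e - y) y := by
    intro i
    have := diag_ddPow2 (e.1 - i.1, e.2 - i.2) c (m.1 - i.1, m.2 - i.2) S
      fun y hy => hmem y (by rwa [hidx] at hy)
    rw [this, hidx]
  rw [hL, Finset.sum_image fun _ _ _ _ h => sub_right_injective h, Finset.smul_sum]
  simp only [hR, Finset.smul_sum]
  rw [Finset.sum_comm]
  refine Finset.sum_congr rfl fun y _ => ?_
  simp only [smul_smul]
  rw [← Finset.sum_smul, sub_sub_cancel]
  congr 1
  have h₁ := sum_signedChoose_mul e.1 m.1 y.1 M hM₁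
  have h₂ := sum_signedChoose_mul e.2 m.2 y.2 M hM₂
  have e₁ : m.1 - 1 - (m - 1 - e - y).1 = y.1 + e.1 := by simp; ring
  have e₂ : m.2 - 1 - (m - 1 - e - y).2 = y.2 + e.2 := by simp; ring
  rw [e₁, e₂, mul_mul_mul_comm, ← h₁, ← h₂, Finset.sum_mul_sum, Finset.sum_product]
  refine Finset.sum_congr rfl fun i _ => Finset.sum_congr rfl fun j _ => ?_
  ring

theorem diag_ddPow2_eq_zero {e : Idx K}
    (he : ¬ ((∃ N : ℕ, (N : K) = e.1) ∧ ∃ N : ℕ, (N : K) = e.2)) (c : Dist2 K E) (m : Idx K) :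
    diag K E (ddPow2 K E e c) m = 0 := by
  refine (finsum_congr fun x => ?_).trans finsum_zero
  rw [ddPow2_apply]
  rcases not_and_or.1 he with h | h <;> simp [signedChoose_eq_zero h]

theorem negOnePow_add_natCast {n : Idx K} (hn : Kbar K n) (i : ℕ × ℕ) :
    negOnePow K (n.1 + i.1 - (n.2 + i.2)) =
      negOnePow K (n.1 - n.2) * (-1 : K) ^ (i.1 + i.2) := by
  obtain ⟨z, hz⟩ := hn
  have : n.1 + i.1 - (n.2 + i.2) = ((z + i.1 - i.2 : ℤ) : K) := by
    push_cast; rw [hz]; ring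
  rw [this, ← hz, negOnePow_intCast, negOnePow_intCast, zpow_sub₀ (by simp), zpow_add₀ (by simp),
    zpow_natCast, zpow_natCast, pow_add, div_eq_mul_inv, ← inv_pow, inv_neg, inv_one, mul_assoc]

theorem exists_nat_bound (x : K) : ∃ M : ℕ, ∀ N : ℕ, (N : K) = x → N < M := by
  by_cases h : ∃ j : ℕ, (j : K) = x
  · obtain ⟨j, rfl⟩ := h
    exact ⟨j + 1, fun N hN => by rw [Nat.cast_injective hN]; exact Nat.lt_succ_self j⟩
  · exact ⟨0, fun N hN => absurd ⟨N, hN⟩ h⟩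

theorem exists_nat_bound_of_fintype {ι : Type*} [Fintype ι] (f : ι → Idx K) :
    ∃ M : ℕ, ∀ k, ∀ N : ℕ, ((N : K) = (f k).1 ∨ (N : K) = (f k).2) → N < M := by
  choose M₁ h₁ using fun k => exists_nat_bound (f k).1
  choose M₂ h₂ using fun k => exists_nat_bound (f k).2
  refine ⟨∑ k, (M₁ k + M₂ k), fun k N hN => ?_⟩
  have : M₁ k + M₂ k ≤ ∑ k, (M₁ k + M₂ k) :=
    Finset.single_le_sum (f := fun k => M₁ k + M₂ k) (fun _ _ => Nat.zero_le _)
      (Finset.mem_univ k)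
  rcases hN with hN | hN
  · have := h₁ k N hN; omega
  · have := h₂ k N hN; omega

/-- The `(𝐧)`-th product of `b` and `a` expressed through an OPE of `a` and `b`. -/
theorem koszul_smul_prodAt {a b : EDist1 K E} {pa pb : ZMod 2}
    {r : ℕ} {c : Fin r → EDist2 K E} {h : Fin r → Idx K} (hch : IsOPE K E pa pb a b c h)
    {s : ℕ} {c' : Fin s → EDist2 K E} {h' : Fin s → Idx K} (hc' : IsOPE K E pb pa b a c' h')
    (n : Idx K) (v : E) (m : Idx K) :
    koszul K pa pb • prodAt K E c' h' n v m =
      ∑ k, negOnePow K ((-h k).1 - (-h k).2) • diag K E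
        (ddPow2 K E ((h k).1 - 1 - n.1, (h k).2 - 1 - n.2) fun x y => ev2 K E (c k) v y x) m := by
  have key := sum_diag_ddPow2_eq_zero (Sum.elim h' h)
    (Sum.elim (fun j => koszul K pa pb • ev2 K E (c' j) v)
      fun k => (-negOnePow K ((-h k).1 - (-h k).2)) • fun x y => ev2 K E (c k) v y x) ?_ ?_ n m
  · simp only [Fintype.sum_sum_type, Sum.elim_inl, Sum.elim_inr, diag_ddPow2_smul] at key
    simp only [neg_smul, Finset.sum_neg_distrib] at key
    rw [prodAt, Finset.smul_sum]
    exact add_neg_eq_zero.1 key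
  · rintro (j | k)
    · exact (hc'.2.1 j v).smul _
    · exact (hch.2.1 k v).swap.smul _
  · intro x y
    simp only [Fintype.sum_sum_type, Sum.elim_inl, Sum.elim_inr, zwPow_smul]
    simp only [neg_smul, Finset.sum_neg_distrib, ← Finset.smul_sum]
    rw [← hc'.2.2.1 v x y, hch.2.2.2 v y x, add_neg_eq_zero]
    exact Finset.sum_congr rfl fun k _ => zwPowW_eq _ _ _ _

end Coefficients


/-- local distributions satisfy skew-symmetry for (∂_z, ∂_z̄). -/
theorem stmt_11 (K : Type*) [Field K] [CharZero K]
    (E : Type*) [AddCommGroup E] [Module K E]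
    (evE odE : Submodule K E) (hgr : IsCompl evE odE)
    (a b : EDist1 K E) (pa pb : ZMod 2)
    (ha : EDistPar K evE odE a pa) (hb : EDistPar K evE odE b pb)
    {r : ℕ} (c : Fin r → EDist2 K E) (h : Fin r → Idx K)
    (hch : IsOPE K E pa pb a b c h)
    {s : ℕ} (c' : Fin s → EDist2 K E) (h' : Fin s → Idx K)
    (hc' : IsOPE K E pb pa b a c' h') :
    ∀ n : Idx K, Kbar K n → ∀ v : E,
      (Function.support (fun i : ℕ × ℕ =>
        ((i.1.factorial : K)⁻¹ * (i.2.factorial : K)⁻¹ *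
            negOnePow K (n.1 + i.1 - (n.2 + i.2))) •
          (dz K E)^[i.1] ((dzb K E)^[i.2]
            (prodAt K E c h (n.1 + i.1, n.2 + i.2) v)))).Finite ∧
      ∀ m : Idx K,
        koszul K pa pb • prodAt K E c' h' n v m =
          ∑ᶠ i : ℕ × ℕ, ((i.1.factorial : K)⁻¹ * (i.2.factorial : K)⁻¹ *
              negOnePow K (n.1 + i.1 - (n.2 + i.2))) •
            (dz K E)^[i.1] ((dzb K E)^[i.2]
              (prodAt K E c h (n.1 + i.1, n.2 + i.2) v)) m := by
  intro n hn v
  obtain ⟨M, hM⟩ := exists_nat_bound_of_fintype fun k => h k - 1 - n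
  have hprod : ∀ i : ℕ × ℕ, i ∉ Finset.range M ×ˢ Finset.range M → ∀ m,
      prodAt K E c h (n.1 + i.1, n.2 + i.2) v m = 0 := by
    intro i hi m
    refine Finset.sum_eq_zero fun k _ => diag_ddPow2_eq_zero ?_ _ _
    rintro ⟨⟨N₁, h₁⟩, ⟨N₂, h₂⟩⟩
    have b₁ := hM k (N₁ + i.1) (Or.inl (by
      rw [Nat.cast_add, h₁]; simp only [Prod.fst_sub, Prod.fst_one]; ring))
    have b₂ := hM k (N₂ + i.2) (Or.inr (by
      rw [Nat.cast_add, h₂]; simp only [Prod.snd_sub, Prod.snd_one]; ring))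
    exact hi (Finset.mem_product.2 ⟨Finset.mem_range.2 (by omega), Finset.mem_range.2 (by omega)⟩)
  have hterm : ∀ (i : ℕ × ℕ) (m : Idx K), ((i.1.factorial : K)⁻¹ * (i.2.factorial : K)⁻¹ *
        negOnePow K (n.1 + i.1 - (n.2 + i.2))) • (dz K E)^[i.1] ((dzb K E)^[i.2]
          (prodAt K E c h (n.1 + i.1, n.2 + i.2) v)) m =
      (negOnePow K (n.1 - n.2) * ((-1 : K) ^ (i.1 + i.2) *
        (signedChoose K (i.1 : K) m.1 * signedChoose K (i.2 : K) m.2))) •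
          prodAt K E c h (n.1 + i.1, n.2 + i.2) v (m.1 - i.1, m.2 - i.2) := by
    intro i m
    rw [mul_comm, mul_smul, dz_dzb_iterate_apply, negOnePow_add_natCast hn, smul_smul, mul_assoc]
  refine ⟨(Finset.finite_toSet (Finset.range M ×ˢ Finset.range M)).subset fun i hi => ?_,
    fun m => ?_⟩
  · by_contra hi'
    refine hi (funext fun m => ?_)
    exact (hterm i m).trans (by rw [hprod i hi', smul_zero]; rfl)
  · simp only [hterm]
    rw [koszul_smul_prodAt hch hc',
      finsum_eq_sum_of_support_subset (s := Finset.range M ×ˢ Finset.range M)]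
    · simp only [prodAt, Finset.smul_sum]
      rw [Finset.sum_comm]
      refine Finset.sum_congr rfl fun k _ => ?_
      set e : Idx K := ((h k).1 - 1 - n.1, (h k).2 - 1 - n.2) with he
      have hsum := negOnePow_smul_diag_ddPow2_swap e (ev2 K E (c k) v) (hch.2.1 k v) m M
        (fun N hN => hM k N (Or.inl hN)) (fun N hN => hM k N (Or.inr hN))
      have hidx : ∀ i : ℕ × ℕ, ((h k).1 - 1 - (n.1 + i.1), (h k).2 - 1 - (n.2 + i.2)) =
          (e.1 - i.1, e.2 - i.2) := by
        intro i; simp only [he, sub_sub, add_assoc]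
      simp only [hidx, mul_smul (negOnePow K (n.1 - n.2)), ← Finset.smul_sum]
      rw [← hsum, smul_smul]
      by_cases hN : (∃ N : ℕ, (N : K) = e.1) ∧ ∃ N : ℕ, (N : K) = e.2
      · obtain ⟨⟨N₁, h₁⟩, ⟨N₂, h₂⟩⟩ := hN
        congr 1
        obtain ⟨z, hz⟩ := hn
        have hsub : (-h k).1 - (-h k).2 = ((-z - N₁ + N₂ : ℤ) : K) := by
          push_cast
          rw [hz, h₁, h₂, he, Prod.fst_neg, Prod.snd_neg]
          ring
        rw [hsub, ← hz, ← h₁, ← h₂, negOnePow_intCast, negOnePow_intCast, negOnePow_natCast,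
          negOnePow_natCast, zpow_add₀ (by simp), zpow_sub₀ (by simp), zpow_neg, ← inv_zpow,
          inv_neg, inv_one, zpow_natCast, zpow_natCast, div_eq_mul_inv, ← inv_pow, inv_neg,
          inv_one, mul_assoc]
      · rw [diag_ddPow2_eq_zero hN, smul_zero, smul_zero]
    · intro i hi
      by_contra hi'
      exact hi (by simp only [hprod i hi', smul_zero])

end OPEA
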